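/- Let G be a finite simple graph on vertex set V, t ≥ 1 a natural number, and C₁, …, C_h ⊆ V subsets such that for all i ≠ j and all u ∈ C_i, v ∈ C_j: u ≠ v and, if u and v are reachable from each other, dist_G(u,v) ≥ 2t − 1. Then: (i) the balls Ĉ_i = B_{t−1}(C_i) are pairwise disjoint; (ii) letting, for each i, H_i be a minimum-cardinality set of edges of G with both endpoints in Ĉ_i such that every edge {u,v} of G with u,v ∈ C_i admits a walk of length at most t using only edges of H_i, and letting ℋ be a minimum-cardinality set of edges with both endpoints in Ĉ = ⋃_i Ĉ_i such that every edge {u,v} of G with u,v in a common C_i admits a walk of length at most t using only edges of ℋ, we have |⋃_{i=1}^{h} H_i| = |ℋ|. -/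

import Mathlib

/-- The ball of radius `r` around a set `S`. -/
def sgBall {V : Type*} (G : SimpleGraph V) (r : ℕ) (S : Set V) : Set V :=
  {x | ∃ s ∈ S, G.Reachable s x ∧ G.dist x s ≤ r}

/-- `H` is a local `t`-spanner for the cluster `Ci`: its edges lie inside the
`(t−1)`-ball around `Ci` and every edge of `G` inside `Ci` is spanned by a walk of
length at most `t` using edges of `H`. -/
def localGood {V : Type*} (G : SimpleGraph V) (t : ℕ) (Ci : Set V)
    (H : Set (Sym2 V)) : Prop :=
  H ⊆ G.edgeSet ∧ (∀ e ∈ H, ∀ x ∈ e, x ∈ sgBall G (t - 1) Ci) ∧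
  ∀ u v : V, G.Adj u v → u ∈ Ci → v ∈ Ci →
    ∃ p : G.Walk u v, p.length ≤ t ∧ ∀ e ∈ p.edges, e ∈ H

/-- `H` is a global `t`-spanner for all intra-cluster edges of the clusters `C i`,
using only edges inside `⋃ i, B_{t−1}(C i)`. -/
def globalGood {V : Type*} (G : SimpleGraph V) (t : ℕ) {h : ℕ} (C : Fin h → Set V)
    (H : Set (Sym2 V)) : Prop :=
  H ⊆ G.edgeSet ∧ (∀ e ∈ H, ∀ x ∈ e, x ∈ ⋃ i, sgBall G (t - 1) (C i)) ∧
  ∀ u v : V, G.Adj u v → (∃ i, u ∈ C i ∧ v ∈ C i) →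
    ∃ p : G.Walk u v, p.length ≤ t ∧ ∀ e ∈ p.edges, e ∈ H

/-- A vertex on a walk of length at most `t` between two points of `S` lies in the
`(t - 1)`-ball around `S`. -/
theorem mem_sgBall_of_mem_support {V : Type*} {G : SimpleGraph V} {t : ℕ} (ht : 1 ≤ t)
    {S : Set V} {u v x : V} (hu : u ∈ S) (hv : v ∈ S) (p : G.Walk u v) (hp : p.length ≤ t)
    (hx : x ∈ p.support) : x ∈ sgBall G (t - 1) S := by
  classical
  have hlen := congrArg SimpleGraph.Walk.length (p.take_spec hx)
  rw [SimpleGraph.Walk.length_append] at hlen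
  have h₁ := SimpleGraph.dist_le (p.takeUntil x hx).reverse
  have h₂ := SimpleGraph.dist_le (p.dropUntil x hx)
  rw [SimpleGraph.Walk.length_reverse] at h₁
  by_cases hlt : G.dist x u ≤ t - 1
  · exact ⟨u, hu, (p.takeUntil x hx).reachable, hlt⟩
  · exact ⟨v, hv, (p.dropUntil x hx).reachable.symm, by omega⟩

/-- Balls of radius `t - 1` around sets at distance at least `2 * t - 1` are disjoint. -/
theorem disjoint_sgBall {V : Type*} {G : SimpleGraph V} {t : ℕ} (ht : 1 ≤ t) {S T : Set V}
    (hsep : ∀ u ∈ S, ∀ v ∈ T, G.Reachable u v → 2 * t - 1 ≤ G.dist u v) :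
    Disjoint (sgBall G (t - 1) S) (sgBall G (t - 1) T) := by
  rw [Set.disjoint_left]
  rintro x ⟨u, hu, hux, hxu⟩ ⟨v, hv, hvx, hxv⟩
  obtain ⟨p, hp⟩ := hux.exists_walk_length_eq_dist
  obtain ⟨q, hq⟩ := hvx.exists_walk_length_eq_dist
  have hle := SimpleGraph.dist_le (p.append q.reverse)
  rw [SimpleGraph.Walk.length_append, SimpleGraph.Walk.length_reverse, hp, hq,
    SimpleGraph.dist_comm (u := u) (v := x), SimpleGraph.dist_comm (u := v) (v := x)] at hle
  have := hsep u hu v hv (hux.trans hvx.symm)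
  omega

/-- Restricting a global spanner to the edges inside one ball gives a local spanner. -/
theorem globalGood.localGood_restrict {V : Type*} {G : SimpleGraph V} {t : ℕ} (ht : 1 ≤ t)
    {h : ℕ} {C : Fin h → Set V} {K : Set (Sym2 V)} (hK : globalGood G t C K) (i : Fin h) :
    localGood G t (C i) {e ∈ K | ∀ x ∈ e, x ∈ sgBall G (t - 1) (C i)} := by
  refine ⟨fun e he => hK.1 he.1, fun e he => he.2, fun u v huv hu hv => ?_⟩
  obtain ⟨p, hp, hpK⟩ := hK.2.2 u v huv ⟨i, hu, hv⟩
  refine ⟨p, hp, fun e he => ⟨hpK e he, fun x hx => ?_⟩⟩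
  exact mem_sgBall_of_mem_support ht hu hv p hp (p.mem_support_of_mem_edges he hx)

/-- A union of local spanners is a global spanner. -/
theorem globalGood_iUnion {V : Type*} {G : SimpleGraph V} {t h : ℕ} {C : Fin h → Set V}
    {H : Fin h → Set (Sym2 V)} (hH : ∀ i, localGood G t (C i) (H i)) :
    globalGood G t C (⋃ i, H i) := by
  refine ⟨Set.iUnion_subset fun i => (hH i).1, fun e he x hx => ?_, ?_⟩
  · obtain ⟨i, hi⟩ := Set.mem_iUnion.1 he
    exact Set.mem_iUnion.2 ⟨i, (hH i).2.1 e hi x hx⟩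
  · rintro u v huv ⟨i, hu, hv⟩
    obtain ⟨p, hp, hpH⟩ := (hH i).2.2 u v huv hu hv
    exact ⟨p, hp, fun e he => Set.mem_iUnion.2 ⟨i, hpH e he⟩⟩

/-- Lemma 6.16: for a `(2t−1)`-separated family of clusters, the `(t−1)`-balls are
pairwise disjoint, and the union of minimum local `t`-spanners has exactly the
cardinality of a minimum global `t`-spanner. -/
theorem stmt_12 {V : Type*} [Fintype V] (G : SimpleGraph V) (t : ℕ) (ht : 1 ≤ t)
    (h : ℕ) (C : Fin h → Set V)
    (hsep : ∀ i j : Fin h, i ≠ j → ∀ u ∈ C i, ∀ v ∈ C j,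
      u ≠ v ∧ (G.Reachable u v → 2 * t - 1 ≤ G.dist u v))
    (H : Fin h → Set (Sym2 V))
    (hHgood : ∀ i, localGood G t (C i) (H i))
    (hHmin : ∀ i, ∀ H', localGood G t (C i) H' → (H i).ncard ≤ H'.ncard)
    (ℋ : Set (Sym2 V)) (hℋ : globalGood G t C ℋ)
    (hℋmin : ∀ H', globalGood G t C H' → ℋ.ncard ≤ H'.ncard) :
    (∀ i j : Fin h, i ≠ j →
      Disjoint (sgBall G (t - 1) (C i)) (sgBall G (t - 1) (C j))) ∧
    (⋃ i, H i).ncard = ℋ.ncard := by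
  have hdisj : ∀ i j : Fin h, i ≠ j →
      Disjoint (sgBall G (t - 1) (C i)) (sgBall G (t - 1) (C j)) := fun i j hij =>
    disjoint_sgBall ht fun u hu v hv => (hsep i j hij u hu v hv).2
  refine ⟨hdisj, le_antisymm ?_ (hℋmin _ (globalGood_iUnion hHgood))⟩
  let K : Fin h → Set (Sym2 V) := fun i => {e ∈ ℋ | ∀ x ∈ e, x ∈ sgBall G (t - 1) (C i)}
  have hK : Pairwise (Function.onFun Disjoint K) := by
    intro i j hij
    refine Set.disjoint_left.2 fun e hi hj => ?_
    exact Set.disjoint_left.1 (hdisj i j hij) (hi.2 _ e.out_fst_mem) (hj.2 _ e.out_fst_mem)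
  calc (⋃ i, H i).ncard ≤ ∑ i, (H i).ncard := Set.ncard_iUnion_le_of_fintype _
    _ ≤ ∑ i, (K i).ncard :=
      Finset.sum_le_sum fun i _ => hHmin i _ (hℋ.localGood_restrict ht i)
    _ = (⋃ i, K i).ncard := by
      rw [Set.ncard_iUnion_of_finite (fun i => Set.toFinite _) hK, finsum_eq_sum_of_fintype]
    _ ≤ ℋ.ncard := Set.ncard_le_ncard (Set.iUnion_subset fun i e he => he.1) (Set.toFinite _)
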